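/- Proposition 4.3 (pullpushdecomp) for GL_n: fix 1 ≤ i, j ≤ n−1 with i ≠ j, fix g ∈ GL_n(F), and for each z ∈ (W_j)^{i,j} fix a reduced word z = s_{k_1}⋯s_{k_r} (r = ℓ(z)). Then the map from the disjoint union ⊔_{z ∈ (W_j)^{i,j}} F^{ℓ(z)} to G/P_i sending (z; d_1, …, d_r) to g x_{k_1}(d_1) n_{k_1}^{-1} ⋯ x_{k_r}(d_r) n_{k_r}^{-1} P_i is a bijection onto the set {hP_i : h ∈ G, hP_j = gP_j}; in particular every element of this set has a unique such expression. -/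

import Mathlib

open Matrix

variable (F : Type*) [Field F] (n : ℕ)

/-- The Borel subgroup `B` of invertible upper-triangular matrices in `GL_n(F)`. -/
def Bsub : Subgroup (GL (Fin n) F) where
  carrier := {g | BlockTriangular (g : Matrix (Fin n) (Fin n) F) (id : Fin n → Fin n)}
  one_mem' := blockTriangular_one
  mul_mem' := fun ha hb => ha.mul hb
  inv_mem' := by
    intro g hg
    have : Invertible (g : Matrix (Fin n) (Fin n) F) := g.invertible
    have h := blockTriangular_inv_of_blockTriangular (M := (g : Matrix (Fin n) (Fin n) F)) hg
    simpa [coe_units_inv] using h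

/-- The permutation matrix of `w`, with a `1` in position `(w k, k)` for each `k`,
as an element of `GL_n(F)`. -/
def permGL (w : Equiv.Perm (Fin n)) : GL (Fin n) F :=
  { val := (w⁻¹).permMatrix F
    inv := w.permMatrix F
    val_inv := by
      rw [Equiv.Perm.permMatrix, Equiv.Perm.permMatrix, ← PEquiv.toMatrix_trans,
        ← Equiv.toPEquiv_trans,
        show Equiv.trans w⁻¹ w = Equiv.refl (Fin n) from Equiv.symm_trans_self w,
        Equiv.toPEquiv_refl, PEquiv.toMatrix_refl]
    inv_val := by
      rw [Equiv.Perm.permMatrix, Equiv.Perm.permMatrix, ← PEquiv.toMatrix_trans,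
        ← Equiv.toPEquiv_trans,
        show Equiv.trans w w⁻¹ = Equiv.refl (Fin n) from Equiv.self_trans_symm w,
        Equiv.toPEquiv_refl, PEquiv.toMatrix_refl] }

/-- The double coset `B w B ⊆ GL_n(F)`. -/
def doubleCoset (w : Equiv.Perm (Fin n)) : Set (GL (Fin n) F) :=
  {g | ∃ b₁ ∈ Bsub F n, ∃ b₂ ∈ Bsub F n, g = b₁ * permGL F n w * b₂}

/-- The elementary unipotent matrix `I + c E_{a b}` (for `a ≠ b`) as an element of `GL_n(F)`. -/
def elemGL (a b : Fin n) (hab : a ≠ b) (c : F) : GL (Fin n) F :=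
  { val := transvection a b c
    inv := transvection a b (-c)
    val_inv := by
      rw [transvection_mul_transvection_same _ _ hab, add_neg_cancel, transvection_zero]
    inv_val := by
      rw [transvection_mul_transvection_same _ _ hab, neg_add_cancel, transvection_zero] }

/-- `x_k(c) = I + c E_{k,k+1}` (rows/columns of `Fin n` being numbered `1, …, n`),
for `1 ≤ k ≤ n-1`; junk value `1` for out-of-range `k`. -/
def xGL (k : ℕ) (c : F) : GL (Fin n) F :=
  if h : 0 < k ∧ k < n then
    elemGL F n ⟨k - 1, by omega⟩ ⟨k, h.2⟩ (by simp [Fin.ext_iff]; omega) c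
  else 1

/-- `y_k(c) = I + c E_{k+1,k}`, for `1 ≤ k ≤ n-1`; junk value `1` for out-of-range `k`. -/
def yGL (k : ℕ) (c : F) : GL (Fin n) F :=
  if h : 0 < k ∧ k < n then
    elemGL F n ⟨k, h.2⟩ ⟨k - 1, by omega⟩ (by simp [Fin.ext_iff]; omega) c
  else 1

/-- `n_k = (I + E_{k,k+1})(I − E_{k+1,k})(I + E_{k,k+1})`. -/
def nGL (k : ℕ) : GL (Fin n) F := xGL F n k 1 * yGL F n k (-1) * xGL F n k 1

/-- The adjacent transposition `s_k = (k, k+1)` (with `1, …, n` numbering),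
for `1 ≤ k ≤ n-1`; junk value `1` for out-of-range `k`. -/
def sT (k : ℕ) : Equiv.Perm (Fin n) :=
  if h : 0 < k ∧ k < n then Equiv.swap ⟨k - 1, by omega⟩ ⟨k, h.2⟩ else 1

/-- The length `ℓ(w)` of a permutation: its number of inversions. -/
def invCount (w : Equiv.Perm (Fin n)) : ℕ :=
  (Finset.univ.filter fun p : Fin n × Fin n => p.1 < p.2 ∧ w p.2 < w p.1).card

/-- `l` is a reduced word for `w`: a minimal-length expression of `w` as a product of
adjacent transpositions. -/
def IsReducedWord (l : List ℕ) (w : Equiv.Perm (Fin n)) : Prop :=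
  (∀ k ∈ l, 0 < k ∧ k < n) ∧ (l.map (sT n)).prod = w ∧
    ∀ l' : List ℕ, (∀ k ∈ l', 0 < k ∧ k < n) → (l'.map (sT n)).prod = w →
      l.length ≤ l'.length

/-- The product `x_{i₁}(c₁) n_{i₁}⁻¹ ⋯ x_{i_ℓ}(c_ℓ) n_{i_ℓ}⁻¹` attached to a word
`l = [i₁, …, i_ℓ]` and parameters `c : Fin l.length → F`. -/
def prodWord (l : List ℕ) (c : Fin l.length → F) : GL (Fin n) F :=
  (List.ofFn fun m : Fin l.length => xGL F n (l.get m) (c m) * (nGL F n (l.get m))⁻¹).prod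

/-- The standard maximal parabolic subgroup `P_j ≤ GL_n(F)` (for `1 ≤ j ≤ n-1`):
the stabilizer of `span(e_1, …, e_j)`, i.e. the invertible block upper-triangular matrices
with diagonal blocks of sizes `j` and `n - j`. -/
def Pmax (j : ℕ) : Subgroup (GL (Fin n) F) where
  carrier := {g | BlockTriangular (g : Matrix (Fin n) (Fin n) F)
    (fun a : Fin n => if (a : ℕ) < j then (0 : ℕ) else 1)}
  one_mem' := blockTriangular_one
  mul_mem' := fun ha hb => ha.mul hb
  inv_mem' := by
    intro g hg
    have : Invertible (g : Matrix (Fin n) (Fin n) F) := g.invertible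
    have h := blockTriangular_inv_of_blockTriangular (M := (g : Matrix (Fin n) (Fin n) F)) hg
    simpa [coe_units_inv] using h

/-- `W_j = {w ∈ S_n : w({1,…,j}) = {1,…,j}}`. -/
def Wfix (j : ℕ) : Set (Equiv.Perm (Fin n)) :=
  {w | (fun a => w a) '' {a : Fin n | (a : ℕ) < j} = {a : Fin n | (a : ℕ) < j}}

/-- `W^j`: the set of permutations of minimal length (fewest inversions) in their left coset
`u W_j`. -/
def minReps (j : ℕ) : Set (Equiv.Perm (Fin n)) :=
  {u | ∀ y ∈ Wfix n j, invCount n u ≤ invCount n (u * y)}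

/-- `(W_j)^{i,j}`: the set of elements of `W_j` of minimal length in their left coset
`z W_{i,j}` inside `W_j`, where `W_{i,j} = W_i ∩ W_j`. -/
def minRepsIn (i j : ℕ) : Set (Equiv.Perm (Fin n)) :=
  {z | z ∈ Wfix n j ∧ ∀ v ∈ Wfix n i ∩ Wfix n j, invCount n z ≤ invCount n (z * v)}


section PP

variable {F} {n}

/-- image of a subspace -/
def actS (h : GL (Fin n) F) (V : Submodule F (Fin n → F)) : Submodule F (Fin n → F) :=
  V.map (Matrix.mulVecLin (h : Matrix (Fin n) (Fin n) F))

lemma inv_mulVec_mulVec (h : GL (Fin n) F) (v : Fin n → F) :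
    ((h⁻¹ : GL (Fin n) F) : Matrix (Fin n) (Fin n) F) *ᵥ ((h : Matrix (Fin n) (Fin n) F) *ᵥ v) = v := by
  rw [Matrix.mulVec_mulVec, ← Units.val_mul, inv_mul_cancel, Units.val_one, Matrix.one_mulVec]

lemma mulVec_inv_mulVec (h : GL (Fin n) F) (v : Fin n → F) :
    (h : Matrix (Fin n) (Fin n) F) *ᵥ (((h⁻¹ : GL (Fin n) F) : Matrix (Fin n) (Fin n) F) *ᵥ v) = v := by
  rw [Matrix.mulVec_mulVec, ← Units.val_mul, mul_inv_cancel, Units.val_one, Matrix.one_mulVec]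

lemma mem_actS (h : GL (Fin n) F) (V : Submodule F (Fin n → F)) (v : Fin n → F) :
    v ∈ actS h V ↔ ((h⁻¹ : GL (Fin n) F) : Matrix (Fin n) (Fin n) F) *ᵥ v ∈ V := by
  unfold actS
  rw [Submodule.mem_map]
  constructor
  · rintro ⟨u, hu, rfl⟩
    rw [Matrix.mulVecLin_apply, inv_mulVec_mulVec]; exact hu
  · intro hv
    exact ⟨_, hv, by rw [Matrix.mulVecLin_apply, mulVec_inv_mulVec]⟩

lemma mulVec_mem_actS (h : GL (Fin n) F) (V : Submodule F (Fin n → F)) (v : Fin n → F)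
    (hv : v ∈ V) : (h : Matrix (Fin n) (Fin n) F) *ᵥ v ∈ actS h V :=
  ⟨v, hv, rfl⟩

lemma actS_mul (h k : GL (Fin n) F) (V : Submodule F (Fin n → F)) :
    actS (h * k) V = actS h (actS k V) := by
  ext v
  rw [mem_actS, mem_actS, mem_actS, _root_.mul_inv_rev, Units.val_mul, ← Matrix.mulVec_mulVec]

lemma actS_one (V : Submodule F (Fin n → F)) : actS (1 : GL (Fin n) F) V = V := by
  ext v
  rw [mem_actS, inv_one, Units.val_one, Matrix.one_mulVec]

lemma actS_inv_actS (h : GL (Fin n) F) (V : Submodule F (Fin n → F)) :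
    actS h⁻¹ (actS h V) = V := by rw [← actS_mul, inv_mul_cancel, actS_one]

lemma actS_actS_inv (h : GL (Fin n) F) (V : Submodule F (Fin n → F)) :
    actS h (actS h⁻¹ V) = V := by rw [← actS_mul, mul_inv_cancel, actS_one]

lemma actS_mono (h : GL (Fin n) F) {V W : Submodule F (Fin n → F)} (hVW : V ≤ W) :
    actS h V ≤ actS h W := Submodule.map_mono hVW

lemma finrank_actS (h : GL (Fin n) F) (V : Submodule F (Fin n → F)) :
    Module.finrank F (actS h V) = Module.finrank F V := by
  unfold actS
  suffices hinj : Function.Injective (Matrix.mulVecLin (h : Matrix (Fin n) (Fin n) F)) from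
    (LinearEquiv.finrank_eq (Submodule.equivMapOfInjective _ hinj V)).symm
  intro u v huv
  have := congrArg (fun w => ((h⁻¹ : GL (Fin n) F) : Matrix (Fin n) (Fin n) F) *ᵥ w) huv
  simpa only [Matrix.mulVecLin_apply, inv_mulVec_mulVec] using this

variable (F n) in
/-- standard flag -/
def Est (m : ℕ) : Submodule F (Fin n → F) where
  carrier := {v | ∀ a : Fin n, m ≤ (a : ℕ) → v a = 0}
  add_mem' := by
    intro u v hu hv a ha
    simp [hu a ha, hv a ha]
  zero_mem' := by intro a _; rfl
  smul_mem' := by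
    intro c v hv a ha
    simp [hv a ha]

lemma mem_Est {m : ℕ} {v : Fin n → F} : v ∈ Est F n m ↔ ∀ a : Fin n, m ≤ (a : ℕ) → v a = 0 :=
  Iff.rfl

lemma Est_mono {p q : ℕ} (h : p ≤ q) : Est F n p ≤ Est F n q :=
  fun _ hv a ha => hv a (h.trans ha)

lemma Pmax_le (i : ℕ) (h : GL (Fin n) F) (hh : h ∈ Pmax F n i) :
    actS h (Est F n i) ≤ Est F n i := by
  rintro _ ⟨v, hv, rfl⟩ a ha
  rw [Matrix.mulVecLin_apply, Matrix.mulVec, dotProduct]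
  apply Finset.sum_eq_zero
  intro b _
  by_cases hb : (b : ℕ) < i
  · have : (h : Matrix (Fin n) (Fin n) F) a b = 0 := by
      apply hh
      simp [hb, not_lt.mpr ha]
    rw [this, zero_mul]
  · rw [hv b (not_lt.mp hb), mul_zero]

lemma mem_Pmax_iff (i : ℕ) (h : GL (Fin n) F) :
    h ∈ Pmax F n i ↔ actS h (Est F n i) = Est F n i := by
  constructor
  · intro hh
    apply le_antisymm (Pmax_le i h hh)
    have := actS_mono h (Pmax_le i h⁻¹ (inv_mem hh))
    rwa [actS_actS_inv] at this
  · intro hh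
    show BlockTriangular (h : Matrix (Fin n) (Fin n) F) _
    intro a b hab
    have hb : (b : ℕ) < i := by
      by_contra hb
      simp [hb] at hab
      split_ifs at hab <;> omega
    have ha : i ≤ (a : ℕ) := by
      by_contra ha
      simp [hb, not_le.mp ha] at hab
    have hm : Pi.single b (1 : F) ∈ Est F n i := by
      intro c hc
      rw [Pi.single_eq_of_ne]
      rintro rfl
      omega
    have := mulVec_mem_actS h _ _ hm
    rw [hh] at this
    have := this a ha
    rw [Matrix.mulVec_single_one] at this
    exact this

lemma mk_eq_iff (i : ℕ) (h k : GL (Fin n) F) :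
    (QuotientGroup.mk h : GL (Fin n) F ⧸ Pmax F n i) = QuotientGroup.mk k ↔
      actS h (Est F n i) = actS k (Est F n i) := by
  rw [QuotientGroup.eq, mem_Pmax_iff, actS_mul]
  constructor
  · intro e
    have := congrArg (actS h) e
    rw [actS_actS_inv] at this
    exact this.symm
  · intro e
    rw [← e, actS_inv_actS]

open Classical in
/-- pivots -/
noncomputable def Piv (V : Submodule F (Fin n → F)) : Finset (Fin n) :=
  Finset.univ.filter fun m => ∃ v ∈ V, v m ≠ 0 ∧ ∀ a, m < a → v a = 0

lemma mem_Piv {V : Submodule F (Fin n → F)} {m : Fin n} :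
    m ∈ Piv V ↔ ∃ v ∈ V, v m ≠ 0 ∧ ∀ a, m < a → v a = 0 := by simp [Piv]

lemma Piv_mono {V W : Submodule F (Fin n → F)} (h : V ≤ W) : Piv V ⊆ Piv W := by
  intro m hm
  rw [mem_Piv] at *
  obtain ⟨v, hv, h2⟩ := hm
  exact ⟨v, h hv, h2⟩

variable (n) in
/-- initial segment -/
def Sini (p : ℕ) : Finset (Fin n) := Finset.univ.filter fun a => (a : ℕ) < p

lemma mem_Sini {p : ℕ} {a : Fin n} : a ∈ Sini n p ↔ (a : ℕ) < p := by simp [Sini]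

lemma Piv_Est (p : ℕ) : Piv (Est F n p) = Sini n p := by
  ext m
  rw [mem_Piv, mem_Sini]
  constructor
  · rintro ⟨v, hv, h1, h2⟩
    by_contra h
    exact h1 (hv m (not_lt.mp h))
  · intro hm
    refine ⟨Pi.single m 1, ?_, by simp, ?_⟩
    · intro c hc
      rw [Pi.single_eq_of_ne]
      rintro rfl
      omega
    · intro a ha
      rw [Pi.single_eq_of_ne ha.ne']

open Classical in
lemma eq_Est_of_Piv {p : ℕ} {V : Submodule F (Fin n → F)} (h : Piv V = Sini n p) :
    V = Est F n p := by
  apply le_antisymm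
  · intro v hv
    by_contra hcon
    rw [mem_Est] at hcon
    push Not at hcon
    obtain ⟨a, ha, hva⟩ := hcon
    obtain ⟨m, hm, hmax⟩ := Finset.exists_max_image (Finset.univ.filter fun b : Fin n => v b ≠ 0) id
      ⟨a, by simpa using hva⟩
    have hm' : v m ≠ 0 := by simpa using hm
    have hmP : m ∈ Piv V := by
      rw [mem_Piv]
      refine ⟨v, hv, hm', ?_⟩
      intro b hb
      by_contra hvb
      have := hmax b (by simpa using hvb)
      exact absurd hb (not_lt.mpr this)
    rw [h, mem_Sini] at hmP
    have h3 : a ≤ m := hmax a (by simpa using hva)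
    have : (a : ℕ) ≤ m := h3
    omega
  · have key : ∀ q, q ≤ p → Est F n q ≤ V := by
      intro q
      induction q with
      | zero =>
        intro _ v hv
        have : v = 0 := by ext a; exact hv a (Nat.zero_le _)
        rw [this]; exact V.zero_mem
      | succ q ih =>
        intro hq v hv
        by_cases hqn : q < n
        · have hmem : (⟨q, hqn⟩ : Fin n) ∈ Piv V := by
            rw [h, mem_Sini]; exact hq
          rw [mem_Piv] at hmem
          obtain ⟨u, hu, hu1, hu2⟩ := hmem
          have h1 : v - (v ⟨q, hqn⟩ / u ⟨q, hqn⟩) • u ∈ V := by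
            apply ih (by omega)
            intro a ha
            rcases Nat.eq_or_lt_of_le ha with h5 | h5
            · have : a = ⟨q, hqn⟩ := Fin.ext h5.symm
              subst this
              simp [hu1]
            · have e1 := hv a h5
              have e2 := hu2 a h5
              simp [e1, e2]
          have h2 := V.add_mem h1 (V.smul_mem (v ⟨q, hqn⟩ / u ⟨q, hqn⟩) hu)
          simpa using h2
        · apply ih (by omega)
          intro a ha
          have := a.2
          omega
    exact key p le_rfl

lemma card_Sini {p : ℕ} (hp : p ≤ n) : (Sini n p).card = p := by
  unfold Sini
  rw [Fin.card_filter_val_lt]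
  omega


variable (F n) in
/-- one factor -/
def Qk (k : ℕ) (c : F) : GL (Fin n) F := xGL F n k c * (nGL F n k)⁻¹

lemma elemGL_mulVec (a b : Fin n) (hab : a ≠ b) (c : F) (v : Fin n → F) (m : Fin n) :
    ((elemGL F n a b hab c : GL (Fin n) F) : Matrix (Fin n) (Fin n) F).mulVec v m =
      if m = a then v a + c * v b else v m := by
  show (transvection a b c).mulVec v m = _
  rw [transvection, Matrix.add_mulVec, Matrix.one_mulVec, Matrix.single_mulVec]
  by_cases h : m = a
  · subst h; simp
  · simp [h, Function.update_of_ne]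

lemma elemGL_inv (a b : Fin n) (hab : a ≠ b) (c : F) :
    (elemGL F n a b hab c)⁻¹ = elemGL F n a b hab (-c) := by
  ext; rfl

section Q
variable {k : ℕ} (hk : 0 < k ∧ k < n)

lemma Qk_apply (c : F) (v : Fin n → F) (m : Fin n) :
    ((Qk F n k c : GL (Fin n) F) : Matrix (Fin n) (Fin n) F).mulVec v m =
      if m = ⟨k - 1, by omega⟩ then c * v ⟨k - 1, by omega⟩ - v ⟨k, hk.2⟩
      else if m = ⟨k, hk.2⟩ then v ⟨k - 1, by omega⟩ else v m := by
  have hne : (⟨k - 1, by omega⟩ : Fin n) ≠ ⟨k, hk.2⟩ := by simp [Fin.ext_iff]; omega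
  have hne' := hne.symm
  unfold Qk nGL xGL yGL
  simp only [dif_pos hk, _root_.mul_inv_rev, elemGL_inv, Units.val_mul, ← Matrix.mulVec_mulVec,
    elemGL_mulVec, hne, hne', if_true, if_false]
  by_cases h1 : m = ⟨k - 1, by omega⟩
  · simp only [h1, hne, hne', if_true, if_false]; ring
  · by_cases h2 : m = ⟨k, hk.2⟩
    · simp only [h2, hne, hne', if_true, if_false]; ring
    · simp only [h1, h2, if_false]

lemma Qk_inv_apply (c : F) (v : Fin n → F) (m : Fin n) :
    (((Qk F n k c)⁻¹ : GL (Fin n) F) : Matrix (Fin n) (Fin n) F).mulVec v m =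
      if m = ⟨k - 1, by omega⟩ then v ⟨k, hk.2⟩
      else if m = ⟨k, hk.2⟩ then c * v ⟨k, hk.2⟩ - v ⟨k - 1, by omega⟩ else v m := by
  have hne : (⟨k - 1, by omega⟩ : Fin n) ≠ ⟨k, hk.2⟩ := by simp [Fin.ext_iff]; omega
  have hne' := hne.symm
  unfold Qk nGL xGL yGL
  simp only [dif_pos hk, _root_.mul_inv_rev, inv_inv, elemGL_inv, Units.val_mul,
    ← Matrix.mulVec_mulVec,
    elemGL_mulVec, hne, hne', if_true, if_false]
  by_cases h1 : m = ⟨k - 1, by omega⟩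
  · simp only [h1, hne, hne', if_true, if_false]; ring
  · by_cases h2 : m = ⟨k, hk.2⟩
    · simp only [h2, hne, hne', if_true, if_false]; ring
    · simp only [h1, h2, if_false]

lemma sT_apply (m : Fin n) : sT n k m = if m = ⟨k - 1, by omega⟩ then ⟨k, hk.2⟩
      else if m = ⟨k, hk.2⟩ then ⟨k - 1, by omega⟩ else m := by
  unfold sT
  rw [dif_pos hk, Equiv.swap_apply_def]

lemma sT_left : sT n k ⟨k - 1, by omega⟩ = ⟨k, hk.2⟩ := by
  rw [sT_apply hk, if_pos rfl]

lemma sT_right : sT n k ⟨k, hk.2⟩ = ⟨k - 1, by omega⟩ := by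
  unfold sT
  rw [dif_pos hk, Equiv.swap_apply_right]

lemma sT_of_ne {m : Fin n} (h1 : m ≠ ⟨k - 1, by omega⟩) (h2 : m ≠ ⟨k, hk.2⟩) : sT n k m = m := by
  rw [sT_apply hk, if_neg h1, if_neg h2]

lemma sT_mul_self : sT n k * sT n k = 1 := by
  unfold sT
  split_ifs <;> simp

lemma sT_sT (m : Fin n) : sT n k (sT n k m) = m := by
  rw [← Equiv.Perm.mul_apply, sT_mul_self]; rfl

lemma mem_image_sT (S : Finset (Fin n)) (m : Fin n) : m ∈ S.image (sT n k) ↔ sT n k m ∈ S := by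
  rw [Finset.mem_image]
  constructor
  · rintro ⟨a, ha, rfl⟩; rwa [sT_sT]
  · intro h; exact ⟨_, h, sT_sT m⟩

lemma image_sT_sT (S : Finset (Fin n)) : (S.image (sT n k)).image (sT n k) = S := by
  ext m; rw [mem_image_sT, mem_image_sT, sT_sT]

lemma Piv_off {g : GL (Fin n) F}
    (h1 : ∀ v m, m ≠ ⟨k - 1, by omega⟩ → m ≠ ⟨k, hk.2⟩ →
      (g : Matrix (Fin n) (Fin n) F).mulVec v m = v m)
    (h2 : ∀ v : Fin n → F, v ⟨k - 1, by omega⟩ = 0 → v ⟨k, hk.2⟩ = 0 →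
      (g : Matrix (Fin n) (Fin n) F).mulVec v = v)
    (V : Submodule F (Fin n → F)) (m : Fin n) (hm1 : m ≠ ⟨k - 1, by omega⟩) (hm2 : m ≠ ⟨k, hk.2⟩)
    (hm : m ∈ Piv V) : m ∈ Piv (actS g V) := by
  rw [mem_Piv] at *
  obtain ⟨v, hv, hvm, hva⟩ := hm
  refine ⟨_, mulVec_mem_actS g V v hv, ?_, ?_⟩
  · rwa [h1 v m hm1 hm2]
  · intro a ha
    have hm1' : (m : ℕ) ≠ k - 1 := fun h => hm1 (Fin.ext h)
    have hm2' : (m : ℕ) ≠ k := fun h => hm2 (Fin.ext h)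
    by_cases hmk : (m : ℕ) < k - 1
    · rw [h2 v (hva _ hmk) (hva _ (show (m : ℕ) < k by omega))]
      exact hva a ha
    · have ha' : (m : ℕ) < a := ha
      rw [h1 v a]
      · exact hva a ha
      · rintro rfl; simp at ha'; omega
      · rintro rfl; simp at ha'; omega

lemma Piv_Qk_off (c : F) (V : Submodule F (Fin n → F)) (m : Fin n)
    (hm1 : m ≠ ⟨k - 1, by omega⟩) (hm2 : m ≠ ⟨k, hk.2⟩) :
    m ∈ Piv (actS (Qk F n k c) V) ↔ m ∈ Piv V := by
  constructor
  · intro h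
    rw [← actS_inv_actS (Qk F n k c) V]
    refine Piv_off hk ?_ ?_ _ m hm1 hm2 h
    · intro v m h1 h2
      rw [Qk_inv_apply hk, if_neg h1, if_neg h2]
    · intro v h1 h2
      ext m
      rw [Qk_inv_apply hk]
      split_ifs with e1 e2
      · rw [e1, h1, h2]
      · rw [e2, h1, h2]; ring
      · rfl
  · intro h
    refine Piv_off hk ?_ ?_ _ m hm1 hm2 h
    · intro v m h1 h2
      rw [Qk_apply hk, if_neg h1, if_neg h2]
    · intro v h1 h2
      ext m
      rw [Qk_apply hk]
      split_ifs with e1 e2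
      · rw [e1, h1, h2]; ring
      · rw [e2, h1, h2]
      · rfl

lemma k_ne : (⟨k, hk.2⟩ : Fin n) ≠ ⟨k - 1, by omega⟩ := by simp [Fin.ext_iff]; omega

/-- pivot at `k` in the image comes with normalized vector -/
lemma Qk_vec (c : F) (V : Submodule F (Fin n → F)) (h : (⟨k - 1, by omega⟩ : Fin n) ∈ Piv V) :
    ∃ u ∈ actS (Qk F n k c) V, u ⟨k - 1, by omega⟩ = c ∧ u ⟨k, hk.2⟩ = 1 ∧
      ∀ a : Fin n, k < (a : ℕ) → u a = 0 := by
  rw [mem_Piv] at h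
  obtain ⟨v, hv, hvm, hva⟩ := h
  have hvk : v ⟨k, hk.2⟩ = 0 := hva _ (show k - 1 < k by omega)
  refine ⟨_, mulVec_mem_actS _ V _ (V.smul_mem (v ⟨k - 1, by omega⟩)⁻¹ hv), ?_, ?_, ?_⟩
  · rw [Qk_apply hk, if_pos rfl]; simp [hvk, hvm]
  · rw [Qk_apply hk, if_neg (k_ne hk), if_pos rfl]; simp [hvm]
  · intro a ha
    rw [Qk_apply hk, if_neg, if_neg]
    · have := hva a (show k - 1 < (a : ℕ) by omega)
      simp [this]
    · rintro rfl; simp at ha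
    · rintro rfl; simp at ha; omega

lemma Piv_Qk (c : F) (V : Submodule F (Fin n → F)) (h1 : (⟨k - 1, by omega⟩ : Fin n) ∈ Piv V)
    (h2 : (⟨k, hk.2⟩ : Fin n) ∉ Piv V) :
    Piv (actS (Qk F n k c) V) = (Piv V).image (sT n k) := by
  ext m
  rw [mem_image_sT]
  by_cases e1 : m = ⟨k - 1, by omega⟩
  · subst e1
    rw [sT_left hk]
    refine iff_of_false ?_ h2
    intro h
    apply h2
    rw [mem_Piv] at h ⊢
    obtain ⟨u, hu, hum, hua⟩ := h
    rw [mem_actS] at hu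
    have huk : u ⟨k, hk.2⟩ = 0 := hua _ (show k - 1 < k by omega)
    refine ⟨_, hu, ?_, ?_⟩
    · rw [Qk_inv_apply hk, if_neg (k_ne hk), if_pos rfl, huk]
      simpa using hum
    · intro a ha
      have ha' : k < (a : ℕ) := ha
      rw [Qk_inv_apply hk, if_neg, if_neg]
      · exact hua a (show k - 1 < (a : ℕ) by omega)
      · rintro rfl; simp at ha
      · rintro rfl; simp at ha'; omega
  · by_cases e2 : m = ⟨k, hk.2⟩
    · subst e2
      rw [sT_right hk]
      refine iff_of_true ?_ h1
      obtain ⟨u, hu, h3, h4, h5⟩ := Qk_vec hk c V h1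
      rw [mem_Piv]
      exact ⟨u, hu, by rw [h4]; exact one_ne_zero, fun a ha => h5 a ha⟩
    · rw [sT_of_ne hk e1 e2, Piv_Qk_off hk c V m e1 e2]

lemma Piv_Qk_inv (V : Submodule F (Fin n → F)) (h1 : (⟨k - 1, by omega⟩ : Fin n) ∉ Piv V)
    (h2 : (⟨k, hk.2⟩ : Fin n) ∈ Piv V) :
    ∃ c, Piv (actS (Qk F n k c)⁻¹ V) = (Piv V).image (sT n k) := by
  have h2' := h2
  rw [mem_Piv] at h2'
  obtain ⟨u, hu, huk, hua⟩ := h2'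
  set c := u ⟨k - 1, by omega⟩ / u ⟨k, hk.2⟩ with hc
  refine ⟨c, ?_⟩
  have hcu : c * u ⟨k, hk.2⟩ - u ⟨k - 1, by omega⟩ = 0 := by rw [hc]; field_simp; ring
  ext m
  rw [mem_image_sT]
  by_cases e1 : m = ⟨k - 1, by omega⟩
  · subst e1
    rw [sT_left hk]
    refine iff_of_true ?_ h2
    rw [mem_Piv]
    refine ⟨_, mulVec_mem_actS _ V u hu, ?_, ?_⟩
    · rw [Qk_inv_apply hk, if_pos rfl]; exact huk
    · intro a ha
      have ha' : k - 1 < (a : ℕ) := ha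
      by_cases e : a = ⟨k, hk.2⟩
      · rw [e, Qk_inv_apply hk, if_neg (k_ne hk), if_pos rfl, hcu]
      · have e' : (a : ℕ) ≠ k := fun h => e (Fin.ext h)
        rw [Qk_inv_apply hk, if_neg (ne_of_gt ha), if_neg e]
        exact hua a (show k < (a : ℕ) by omega)
  · by_cases e2 : m = ⟨k, hk.2⟩
    · subst e2
      rw [sT_right hk]
      refine iff_of_false ?_ h1
      intro h
      apply h1
      rw [mem_Piv] at h
      obtain ⟨w, hw, hwk, hwa⟩ := h
      rw [mem_actS, inv_inv] at hw
      set t := w ⟨k - 1, by omega⟩ / u ⟨k, hk.2⟩ with ht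
      rw [mem_Piv]
      -- subtract a multiple of u
      refine ⟨_, V.sub_mem hw (V.smul_mem t hu), ?_, ?_⟩
      · rw [Pi.sub_apply, Qk_apply hk, if_pos rfl, Pi.smul_apply, smul_eq_mul]
        have : c * w ⟨k - 1, by omega⟩ - w ⟨k, hk.2⟩ - t * u ⟨k - 1, by omega⟩
            = - w ⟨k, hk.2⟩ := by
          rw [ht, hc]; field_simp; ring
        rw [this]
        simpa using hwk
      · intro a ha
        have ha' : k - 1 < (a : ℕ) := ha
        rw [Pi.sub_apply, Pi.smul_apply, smul_eq_mul]
        by_cases e : a = ⟨k, hk.2⟩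
        · rw [e, Qk_apply hk, if_neg (k_ne hk), if_pos rfl, ht]
          field_simp
          ring
        · have e' : (a : ℕ) ≠ k := fun h => e (Fin.ext h)
          rw [Qk_apply hk, if_neg (ne_of_gt ha), if_neg e, hwa a (show k < (a : ℕ) by omega),
            hua a (show k < (a : ℕ) by omega)]
          ring
    · rw [sT_of_ne hk e1 e2, ← Piv_Qk_off hk c _ m e1 e2, actS_actS_inv]

lemma Qk_inj (c c' : F) (V V' : Submodule F (Fin n → F))
    (h1 : (⟨k - 1, by omega⟩ : Fin n) ∈ Piv V) (h1' : (⟨k - 1, by omega⟩ : Fin n) ∈ Piv V')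
    (h2 : (⟨k, hk.2⟩ : Fin n) ∉ Piv V)
    (h : actS (Qk F n k c) V = actS (Qk F n k c') V') : c = c' ∧ V = V' := by
  have hc : c = c' := by
    by_contra hne
    have h3 : (⟨k - 1, by omega⟩ : Fin n) ∈ Piv (actS (Qk F n k c) V) := by
      obtain ⟨u, hu, a1, a2, a3⟩ := Qk_vec hk c V h1
      obtain ⟨u', hu', b1, b2, b3⟩ := Qk_vec hk c' V' h1'
      rw [← h] at hu'
      rw [mem_Piv]
      refine ⟨_, Submodule.sub_mem _ hu hu', ?_, ?_⟩
      · rw [Pi.sub_apply, a1, b1]; exact sub_ne_zero.mpr hne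
      · intro a ha
        have ha' : k - 1 < (a : ℕ) := ha
        by_cases e : a = ⟨k, hk.2⟩
        · rw [e, Pi.sub_apply, a2, b2, sub_self]
        · have e' : (a : ℕ) ≠ k := fun h => e (Fin.ext h)
          rw [Pi.sub_apply, a3 a (by omega), b3 a (by omega), sub_self]
    rw [Piv_Qk hk c V h1 h2, mem_image_sT, sT_left hk] at h3
    exact h2 h3
  subst hc
  refine ⟨rfl, ?_⟩
  rw [← actS_inv_actS (Qk F n k c) V, h, actS_inv_actS]

end Q


/-- weight -/
def wtS (S : Finset (Fin n)) : ℕ := ∑ m ∈ S, (m : ℕ)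

lemma wtS_sT {k : ℕ} (hk : 0 < k ∧ k < n) (S : Finset (Fin n)) :
    wtS (S.image (sT n k)) + (if (⟨k, hk.2⟩ : Fin n) ∈ S then 1 else 0) =
      wtS S + (if (⟨k - 1, by omega⟩ : Fin n) ∈ S then 1 else 0) := by
  unfold wtS
  rw [Finset.sum_image (fun a _ b _ h => (sT n k).injective h)]
  rw [← Finset.sum_ite_eq' S (⟨k, hk.2⟩ : Fin n) (fun _ => 1),
    ← Finset.sum_ite_eq' S (⟨k - 1, by omega⟩ : Fin n) (fun _ => 1),
    ← Finset.sum_add_distrib, ← Finset.sum_add_distrib]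
  apply Finset.sum_congr rfl
  intro m _
  by_cases e1 : m = ⟨k - 1, by omega⟩
  · subst e1
    rw [sT_left hk, if_neg (k_ne hk).symm, if_pos rfl]
    simp; omega
  · by_cases e2 : m = ⟨k, hk.2⟩
    · subst e2
      rw [sT_right hk, if_neg (k_ne hk), if_pos rfl]
      simp; omega
    · rw [sT_of_ne hk e1 e2, if_neg e1, if_neg e2]

lemma image_cons (k : ℕ) (l : List ℕ) (S : Finset (Fin n)) :
    S.image ⇑((k :: l).map (sT n)).prod = (S.image ⇑(l.map (sT n)).prod).image (sT n k) := by
  rw [Finset.image_image]; rfl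

lemma wtS_word (l : List ℕ) (hl : ∀ k ∈ l, 0 < k ∧ k < n) (S : Finset (Fin n)) :
    wtS (S.image ⇑(l.map (sT n)).prod) ≤ wtS S + l.length := by
  induction l with
  | nil => simp
  | cons k l ih =>
    rw [image_cons]
    have h1 := ih (fun k hk => hl k (List.mem_cons_of_mem _ hk))
    have h2 := wtS_sT (hl k List.mem_cons_self) (S.image ⇑(l.map (sT n)).prod)
    rw [List.length_cons]
    split_ifs at h2 <;> omega

lemma prodWord_cons (k : ℕ) (l : List ℕ) (c : Fin (k :: l).length → F) :
    prodWord F n (k :: l) c = Qk F n k (c 0) * prodWord F n l (fun m => c m.succ) := by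
  unfold prodWord
  simp only [List.length_cons]
  rw [List.ofFn_succ, List.prod_cons]
  rfl

lemma cell (i : ℕ) (l : List ℕ) (hl : ∀ k ∈ l, 0 < k ∧ k < n)
    (hw : wtS ((Sini n i).image ⇑(l.map (sT n)).prod) = wtS (Sini n i) + l.length) :
    (∀ c, Piv (actS (prodWord F n l c) (Est F n i)) = (Sini n i).image ⇑(l.map (sT n)).prod) ∧
    (∀ V : Submodule F (Fin n → F), Piv V = (Sini n i).image ⇑(l.map (sT n)).prod →
      ∃ c, V = actS (prodWord F n l c) (Est F n i)) ∧
    (∀ c c', actS (prodWord F n l c) (Est F n i) = actS (prodWord F n l c') (Est F n i) →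
      c = c') := by
  induction l with
  | nil =>
    have h1 : ∀ c, prodWord F n [] c = 1 := by intro c; simp [prodWord]
    have h2 : (Sini n i).image ⇑(([] : List ℕ).map (sT n)).prod = Sini n i := by simp
    rw [h2]
    refine ⟨?_, ?_, ?_⟩
    · intro c; rw [h1, actS_one, Piv_Est]
    · intro V hV
      refine ⟨fun m => 0, ?_⟩
      rw [h1, actS_one]; exact eq_Est_of_Piv hV
    · intro c c' _; funext m; exact m.elim0
  | cons k l ih =>
    have hk := hl k List.mem_cons_self
    have hl' : ∀ k ∈ l, 0 < k ∧ k < n := fun k hk => hl k (List.mem_cons_of_mem _ hk)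
    have hle := wtS_word l hl' (Sini n i)
    rw [image_cons] at hw ⊢
    set S := (Sini n i).image ⇑(l.map (sT n)).prod with hS
    have h2 := wtS_sT hk S
    rw [List.length_cons] at hw
    have hk1 : (⟨k - 1, by omega⟩ : Fin n) ∈ S := by
      by_contra hc
      rw [if_neg hc] at h2
      omega
    have hk2 : (⟨k, hk.2⟩ : Fin n) ∉ S := by
      intro hc
      rw [if_pos hc, if_pos hk1] at h2
      omega
    rw [if_pos hk1, if_neg hk2] at h2
    obtain ⟨i1, i2, i3⟩ := ih hl' (by omega)
    refine ⟨?_, ?_, ?_⟩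
    · intro c
      rw [prodWord_cons, actS_mul, Piv_Qk hk, i1]
      · rw [i1]; exact hk1
      · rw [i1]; exact hk2
    · intro V hV
      obtain ⟨c, hc⟩ := Piv_Qk_inv hk V
        (by rw [hV, mem_image_sT, sT_left hk]; exact hk2)
        (by rw [hV, mem_image_sT, sT_right hk]; exact hk1)
      rw [hV, image_sT_sT] at hc
      obtain ⟨d, hd⟩ := i2 _ hc
      refine ⟨(Fin.cons c d : Fin (l.length + 1) → F), ?_⟩
      rw [prodWord_cons, actS_mul]
      have e : (fun m => (Fin.cons c d : Fin (l.length + 1) → F) (Fin.succ m)) = d := by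
        funext m; simp
      change V = actS (Qk F n k c) (actS (prodWord F n l
        (fun m => (Fin.cons c d : Fin (l.length + 1) → F) (Fin.succ m))) (Est F n i))
      rw [e, ← hd, actS_actS_inv]
    · intro c c' h
      rw [prodWord_cons, prodWord_cons, actS_mul, actS_mul] at h
      obtain ⟨e1, e2⟩ := Qk_inj hk _ _ _ _ (by rw [i1]; exact hk1) (by rw [i1]; exact hk1)
        (by rw [i1]; exact hk2) h
      have e3 := i3 _ _ e2
      funext m
      refine Fin.cases e1 (fun m => congrFun e3 m) m

/-- increasing away from `i` -/
def Grass (i : ℕ) (z : Equiv.Perm (Fin n)) : Prop :=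
  ∀ a b : Fin n, (a : ℕ) + 1 = b → (b : ℕ) ≠ i → z a < z b

lemma Grass.mono {i : ℕ} {z : Equiv.Perm (Fin n)} (hz : Grass i z) (a b : Fin n) (hab : a < b)
    (h : (b : ℕ) < i ∨ i ≤ (a : ℕ)) : z a < z b := by
  have key : ∀ d : ℕ, ∀ b : Fin n, (b : ℕ) = a + 1 + d → ((b : ℕ) < i ∨ i ≤ (a : ℕ)) →
      z a < z b := by
    intro d
    induction d with
    | zero => intro b hb h; exact hz a b (by omega) (by omega)
    | succ d ih =>
      intro b hb h
      have hb2 := b.2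
      refine lt_trans (ih ⟨a + 1 + d, by omega⟩ rfl (by simp; omega)) (hz _ b (by simp; omega) (by omega))
  have : (a : ℕ) < b := hab
  exact key (b - a - 1) b (by omega) h

lemma grass_unique {i : ℕ} {z z' : Equiv.Perm (Fin n)} (hz : Grass i z) (hz' : Grass i z')
    (h : (Sini n i).image z = (Sini n i).image z') : z = z' := by
  have hu : ∀ a, ((z⁻¹ * z') a : ℕ) < i ↔ (a : ℕ) < i := by
    intro a
    have h1 : z' a ∈ (Sini n i).image z ↔ z' a ∈ (Sini n i).image z' := by rw [h]
    rw [Finset.mem_image, Finset.mem_image] at h1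
    constructor
    · intro ha
      obtain ⟨b, hb, e⟩ := h1.1 ⟨(z⁻¹ * z') a, mem_Sini.2 ha, by simp⟩
      rw [← z'.injective e]; exact mem_Sini.1 hb
    · intro ha
      obtain ⟨b, hb, e⟩ := h1.2 ⟨a, mem_Sini.2 ha, rfl⟩
      have e' : (z⁻¹ * z') a = b := by
        rw [Equiv.Perm.mul_apply, ← e]; simp
      rw [e']; exact mem_Sini.1 hb
  have hmono : StrictMono (z⁻¹ * z') := by
    intro a b hab
    have hab' : (a : ℕ) < b := hab
    by_cases hc : (b : ℕ) < i ∨ i ≤ (a : ℕ)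
    · have h1 := hz'.mono a b hab hc
      by_contra hn
      rcases lt_or_eq_of_le (not_lt.1 hn) with h2 | h2
      · have h3 := hz.mono _ _ h2 (by
          have := hu a
          have := hu b
          omega)
        simp at h3
        exact absurd h1 (not_lt.2 h3.le)
      · exact absurd ((z⁻¹ * z').injective h2) (ne_of_gt hab)
    · have h1 := hu a
      have h2 := hu b
      show ((z⁻¹ * z') a : ℕ) < (z⁻¹ * z') b
      omega
  have h1 : ⇑(z⁻¹ * z') = id := by
    apply (hmono.range_inj strictMono_id).1
    rw [(z⁻¹ * z').surjective.range_eq]; simp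
  have h2 : z⁻¹ * z' = 1 := by ext a; rw [h1]; rfl
  exact inv_mul_eq_one.1 h2

lemma grass_one (i : ℕ) : Grass i (1 : Equiv.Perm (Fin n)) := by
  intro a b hab _
  show (a : ℕ) < b
  omega

lemma down_closed (S : Finset (Fin n))
    (h : ∀ k (hk : 0 < k ∧ k < n), (⟨k, hk.2⟩ : Fin n) ∈ S → (⟨k - 1, by omega⟩ : Fin n) ∈ S) :
    S = Sini n S.card := by
  have key : ∀ d : ℕ, ∀ a b : Fin n, b ∈ S → (b : ℕ) = a + d → a ∈ S := by
    intro d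
    induction d with
    | zero => intro a b hb e; rwa [show a = b from Fin.ext (by omega)]
    | succ d ih =>
      intro a b hb e
      have hb2 := b.2
      refine ih a ⟨b - 1, by omega⟩ (h b ⟨by omega, b.2⟩ hb) (by simp; omega)
  have hex : ∃ p, p ≤ n ∧ S = Sini n p := by
    by_cases hS : S.Nonempty
    · obtain ⟨m, hm, hmax⟩ := Finset.exists_max_image S id hS
      refine ⟨m + 1, m.2, ?_⟩
      ext a
      rw [mem_Sini]
      constructor
      · intro ha
        have : a ≤ m := hmax a ha
        have : (a : ℕ) ≤ m := this
        omega
      · intro ha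
        exact key (m - a) a m hm (by omega)
    · refine ⟨0, by omega, ?_⟩
      rw [Finset.not_nonempty_iff_eq_empty.1 hS]
      ext a; simp [mem_Sini]
  obtain ⟨p, hp, rfl⟩ := hex
  rw [card_Sini hp]

lemma grass_word (i : ℕ) (hi : i ≤ n) : ∀ (N : ℕ) (z : Equiv.Perm (Fin n)), Grass i z →
    wtS ((Sini n i).image z) = N → ∃ l : List ℕ, (∀ k ∈ l, 0 < k ∧ k < n) ∧
      (l.map (sT n)).prod = z ∧ N = wtS (Sini n i) + l.length := by
  intro N
  induction N using Nat.strong_induction_on with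
  | _ N ih =>
    intro z hz hN
    by_cases hd : ∀ k (hk : 0 < k ∧ k < n), (⟨k, hk.2⟩ : Fin n) ∈ (Sini n i).image z →
        (⟨k - 1, by omega⟩ : Fin n) ∈ (Sini n i).image z
    · have h1 := down_closed _ hd
      rw [Finset.card_image_of_injective _ z.injective, card_Sini hi] at h1
      have h2 : z = 1 := by
        apply grass_unique hz (grass_one i)
        rw [h1]; simp
      refine ⟨[], by simp, by simp [h2], ?_⟩
      rw [← hN, h1]; simp
    · push Not at hd
      obtain ⟨k, hk, h1, h2⟩ := hd
      have h3 := wtS_sT hk ((Sini n i).image z)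
      rw [if_pos h1, if_neg h2, Finset.image_image] at h3
      have hg : Grass i (sT n k * z) := by
        intro a b hab hb
        have hlt := hz a b hab hb
        rw [Finset.mem_image] at h1 h2
        obtain ⟨p, hp, hpk⟩ := h1
        rw [mem_Sini] at hp
        have hlt' : (z a : ℕ) < z b := hlt
        show (sT n k (z a) : ℕ) < sT n k (z b)
        rw [sT_apply hk, sT_apply hk]
        by_cases a1 : z a = ⟨k - 1, by omega⟩
        · have a1' : (z a : ℕ) = k - 1 := by rw [a1]
          have hai : ¬ (a : ℕ) < i := fun hc => h2 ⟨a, mem_Sini.2 hc, a1⟩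
          have b1 : z b ≠ ⟨k, hk.2⟩ := by
            intro hc
            rw [← hpk] at hc
            have := z.injective hc
            subst this
            omega
          have b1' : (z b : ℕ) ≠ k := fun h => b1 (Fin.ext h)
          have b2 : z b ≠ ⟨k - 1, by omega⟩ := by rw [← a1]; exact ne_of_gt hlt
          rw [if_pos a1, if_neg b2, if_neg b1]
          show k < (z b : ℕ)
          omega
        · have a1' : (z a : ℕ) ≠ k - 1 := fun h => a1 (Fin.ext h)
          by_cases a2 : z a = ⟨k, hk.2⟩
          · have a2' : (z a : ℕ) = k := by rw [a2]
            have b1 : z b ≠ ⟨k, hk.2⟩ := by rw [← a2]; exact ne_of_gt hlt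
            have b2 : z b ≠ ⟨k - 1, by omega⟩ := by
              intro h
              have : (z b : ℕ) = k - 1 := by rw [h]
              omega
            rw [if_neg a1, if_pos a2, if_neg b2, if_neg b1]
            show k - 1 < (z b : ℕ)
            omega
          · have a2' : (z a : ℕ) ≠ k := fun h => a2 (Fin.ext h)
            rw [if_neg a1, if_neg a2]
            split_ifs with c1 c2
            · have : (z b : ℕ) = k - 1 := by rw [c1]
              show (z a : ℕ) < k
              omega
            · have : (z b : ℕ) = k := by rw [c2]
              show (z a : ℕ) < k - 1
              omega
            · exact hlt
      have h3' : wtS ((Sini n i).image ⇑(sT n k * z)) + 1 = wtS ((Sini n i).image z) := h3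
      obtain ⟨l, l1, l2, l3⟩ := ih (N - 1) (by omega) (sT n k * z) hg (by omega)
      refine ⟨k :: l, ?_, ?_, ?_⟩
      · intro m hm
        rcases List.mem_cons.1 hm with rfl | hm
        · exact hk
        · exact l1 m hm
      · rw [List.map_cons, List.prod_cons, l2, ← mul_assoc, sT_mul_self, one_mul]
      · rw [List.length_cons]; omega

lemma reduced_wt {i : ℕ} (hi : i ≤ n) {z : Equiv.Perm (Fin n)} (hz : Grass i z) {l : List ℕ}
    (hl : IsReducedWord n l z) :
    wtS ((Sini n i).image ⇑(l.map (sT n)).prod) = wtS (Sini n i) + l.length := by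
  obtain ⟨l1, l2, l3⟩ := hl
  obtain ⟨l', m1, m2, m3⟩ := grass_word i hi _ z hz rfl
  have h1 := l3 l' m1 m2
  have h2 := wtS_word l l1 (Sini n i)
  rw [l2] at h2 ⊢
  omega

lemma mem_Wfix {j : ℕ} {w : Equiv.Perm (Fin n)} :
    w ∈ Wfix n j ↔ (Sini n j).image w = Sini n j := by
  unfold Wfix
  rw [Set.mem_ofPred_eq, ← Finset.coe_inj, Finset.coe_image]
  have : ((Sini n j : Finset (Fin n)) : Set (Fin n)) = {a : Fin n | (a : ℕ) < j} := by
    ext a; simp [mem_Sini]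
  rw [this]

lemma Wfix_lt {j : ℕ} {w : Equiv.Perm (Fin n)} (hw : w ∈ Wfix n j) (a : Fin n) :
    (w a : ℕ) < j ↔ (a : ℕ) < j := by
  rw [mem_Wfix] at hw
  rw [← mem_Sini, ← mem_Sini]
  nth_rw 1 [← hw]
  rw [Finset.mem_image]
  constructor
  · rintro ⟨b, hb, e⟩; rwa [← w.injective e]
  · intro h; exact ⟨a, h, rfl⟩

lemma Wfix_of_lt {j : ℕ} {w : Equiv.Perm (Fin n)} (hw : ∀ a, (w a : ℕ) < j ↔ (a : ℕ) < j) :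
    w ∈ Wfix n j := by
  rw [mem_Wfix]
  ext a
  rw [Finset.mem_image]
  constructor
  · rintro ⟨b, hb, rfl⟩
    rw [mem_Sini] at *
    exact (hw b).2 hb
  · intro ha
    refine ⟨w⁻¹ a, ?_, by simp⟩
    rw [mem_Sini] at *
    rw [← hw]; simpa using ha

lemma sT_Wfix {k j : ℕ} (hk : 0 < k ∧ k < n) (hkj : k ≠ j) : sT n k ∈ Wfix n j := by
  apply Wfix_of_lt
  intro a
  rw [sT_apply hk]
  split_ifs with h1 h2
  · rw [h1]; simp; omega
  · rw [h2]; simp; omega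
  · rfl

lemma Wfix_mul {j : ℕ} {w v : Equiv.Perm (Fin n)} (hw : w ∈ Wfix n j) (hv : v ∈ Wfix n j) :
    w * v ∈ Wfix n j := by
  apply Wfix_of_lt
  intro a
  rw [Equiv.Perm.mul_apply, Wfix_lt hw, Wfix_lt hv]

lemma invCount_lt {k : ℕ} (hk : 0 < k ∧ k < n) (z : Equiv.Perm (Fin n))
    (h : z ⟨k, hk.2⟩ < z ⟨k - 1, by omega⟩) : invCount n (z * sT n k) < invCount n z := by
  unfold invCount
  rw [← Finset.card_image_of_injective _ ((sT n k).injective.prodMap (sT n k).injective)]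
  apply Finset.card_lt_card
  rw [Finset.ssubset_iff_of_subset]
  · refine ⟨(⟨k - 1, by omega⟩, ⟨k, hk.2⟩), ?_, ?_⟩
    · simp only [Finset.mem_filter, Finset.mem_univ, true_and]
      exact ⟨show k - 1 < k by omega, h⟩
    · rw [Finset.mem_image]
      rintro ⟨⟨p, q⟩, hpq, e⟩
      rw [Finset.mem_filter] at hpq
      obtain ⟨-, hpq⟩ := hpq
      simp only [Prod.map_apply, Prod.mk.injEq, Equiv.Perm.mul_apply] at hpq e
      have e1 : p = ⟨k, hk.2⟩ := by rw [← sT_sT (k := k) p, e.1, sT_left hk]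
      have e2 : q = ⟨k - 1, by omega⟩ := by rw [← sT_sT (k := k) q, e.2, sT_right hk]
      have h3 : (p : ℕ) < q := hpq.1
      rw [e1, e2] at h3
      simp at h3
      omega
  · intro x hx
    rw [Finset.mem_image] at hx
    obtain ⟨⟨p, q⟩, hpq, rfl⟩ := hx
    rw [Finset.mem_filter] at hpq ⊢
    obtain ⟨-, hpq⟩ := hpq
    simp only [Prod.map_apply, Equiv.Perm.mul_apply] at hpq ⊢
    refine ⟨Finset.mem_univ _, ?_, hpq.2⟩
    obtain ⟨h1, h2⟩ := hpq
    have h1' : (p : ℕ) < q := h1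
    by_cases hp : p = ⟨k - 1, by omega⟩ ∧ q = ⟨k, hk.2⟩
    · rw [hp.1, hp.2, sT_left hk, sT_right hk] at h2
      exact absurd h (not_lt.2 h2.le)
    · show (sT n k p : ℕ) < sT n k q
      rw [sT_apply hk, sT_apply hk]
      simp only [Fin.ext_iff] at hp ⊢
      split_ifs <;> simp <;> omega

lemma minRepsIn_grass {i j : ℕ} {z : Equiv.Perm (Fin n)} (hz : z ∈ minRepsIn n i j) :
    Grass i z := by
  intro a b hab hb
  obtain ⟨hzj, hmin⟩ := hz
  have hk : 0 < (b : ℕ) ∧ (b : ℕ) < n := ⟨by omega, b.2⟩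
  have ea : a = ⟨b - 1, by omega⟩ := Fin.ext (by simp; omega)
  by_cases hbj : (b : ℕ) = j
  · have h1 := Wfix_lt hzj a
    have h2 := Wfix_lt hzj b
    show (z a : ℕ) < z b
    omega
  · by_contra hn
    have hlt : z b < z a := lt_of_le_of_ne (not_lt.1 hn)
      (fun h => by have := z.injective h; rw [this] at hab; omega)
    have h1 := invCount_lt hk z (by rw [← ea]; exact hlt)
    have h2 := hmin (sT n b) ⟨sT_Wfix hk hb, sT_Wfix hk hbj⟩
    omega

lemma exists_perm (j : ℕ) : ∀ (N : ℕ) (V : Submodule F (Fin n → F)), wtS (Piv V) = N →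
    (Piv V ⊆ Sini n j ∨ Sini n j ⊆ Piv V) → ∃ (p : ℕ) (w : Equiv.Perm (Fin n)), w ∈ Wfix n j ∧
      Piv V = (Sini n p).image w ∧ Module.finrank F V = Module.finrank F (Est F n p) := by
  intro N
  induction N using Nat.strong_induction_on with
  | _ N ih =>
    intro V hN hV
    by_cases hd : ∀ k (hk : 0 < k ∧ k < n), (⟨k, hk.2⟩ : Fin n) ∈ Piv V →
        (⟨k - 1, by omega⟩ : Fin n) ∈ Piv V
    · have h1 := down_closed _ hd
      refine ⟨(Piv V).card, 1, Wfix_of_lt (fun a => Iff.rfl), ?_, ?_⟩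
      · simpa using h1
      · rw [← eq_Est_of_Piv h1]
    · push Not at hd
      obtain ⟨k, hk, h1, h2⟩ := hd
      have h3 := wtS_sT hk (Piv V)
      rw [if_pos h1, if_neg h2] at h3
      have hkj : k ≠ j := by
        rintro rfl
        rcases hV with hV | hV
        · have := mem_Sini.1 (hV h1)
          simp at this
        · exact h2 (hV (mem_Sini.2 (by simp; omega)))
      have hs := sT_Wfix hk hkj
      obtain ⟨c, hc⟩ := Piv_Qk_inv hk V h2 h1
      obtain ⟨p, w, hw, e1, e2⟩ := ih (N - 1) (by omega) (actS (Qk F n k c)⁻¹ V)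
        (by rw [hc]; omega) (by
          rw [hc, ← mem_Wfix.1 hs]
          exact hV.imp (fun h => Finset.image_subset_image h) (fun h => Finset.image_subset_image h))
      refine ⟨p, sT n k * w, Wfix_mul hs hw, ?_, ?_⟩
      · rw [← image_sT_sT (k := k) (Piv V), ← hc, e1, Finset.image_image]; rfl
      · rw [← e2, finrank_actS]

lemma Est_finrank_inj {p q : ℕ} (h : Module.finrank F (Est F n p) = Module.finrank F (Est F n q)) :
    Sini n p = Sini n q := by
  have : Est F n p = Est F n q := by
    rcases le_total p q with hpq | hpq
    · exact Submodule.eq_of_le_of_finrank_eq (Est_mono hpq) h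
    · exact (Submodule.eq_of_le_of_finrank_eq (Est_mono hpq) h.symm).symm
  rw [← Piv_Est (F := F), ← Piv_Est (F := F), this]

lemma exists_min (i j : ℕ) (w : Equiv.Perm (Fin n)) (hw : w ∈ Wfix n j) :
    ∃ z ∈ minRepsIn n i j, (Sini n i).image z = (Sini n i).image w := by
  classical
  obtain ⟨z, hz, hmin⟩ := Finset.exists_min_image
    (Finset.univ.filter fun z : Equiv.Perm (Fin n) =>
      z ∈ Wfix n j ∧ (Sini n i).image z = (Sini n i).image w) (invCount n)
    ⟨w, by simp [hw]⟩
  simp only [Finset.mem_filter, Finset.mem_univ, true_and] at hz hmin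
  refine ⟨z, ⟨hz.1, ?_⟩, hz.2⟩
  rintro v ⟨hv1, hv2⟩
  apply hmin
  refine ⟨Wfix_mul hz.1 hv2, ?_⟩
  rw [← hz.2]
  conv_rhs => rw [← mem_Wfix.1 hv1]
  rw [Finset.image_image]; rfl

lemma Qk_Est {k j : ℕ} (hk : 0 < k ∧ k < n) (hkj : k ≠ j) (c : F) :
    actS (Qk F n k c) (Est F n j) = Est F n j := by
  have h1 : actS (Qk F n k c) (Est F n j) ≤ Est F n j := by
    rintro _ ⟨v, hv, rfl⟩ a ha
    rw [Matrix.mulVecLin_apply, Qk_apply hk]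
    split_ifs with e1 e2
    · rw [e1] at ha
      simp only at ha
      rw [hv ⟨k - 1, by omega⟩ ha, hv ⟨k, hk.2⟩ (show j ≤ k by omega)]; ring
    · rw [e2] at ha
      simp only at ha
      exact hv ⟨k - 1, by omega⟩ (show j ≤ k - 1 by omega)
    · exact hv a ha
  exact Submodule.eq_of_le_of_finrank_eq h1 (finrank_actS _ _)

lemma word_Est (i j : ℕ) (l : List ℕ) (hl : ∀ k ∈ l, 0 < k ∧ k < n)
    (hw : wtS ((Sini n i).image ⇑(l.map (sT n)).prod) = wtS (Sini n i) + l.length)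
    (hV : (Sini n i).image ⇑(l.map (sT n)).prod ⊆ Sini n j ∨
      Sini n j ⊆ (Sini n i).image ⇑(l.map (sT n)).prod) (c : Fin l.length → F) :
    actS (prodWord F n l c) (Est F n j) = Est F n j := by
  induction l with
  | nil =>
    have h1 : prodWord F n [] c = 1 := by simp [prodWord]
    rw [h1, actS_one]
  | cons k l ih =>
    have hk := hl k List.mem_cons_self
    have hl' : ∀ k ∈ l, 0 < k ∧ k < n := fun k hk => hl k (List.mem_cons_of_mem _ hk)
    have hle := wtS_word l hl' (Sini n i)
    rw [image_cons] at hw hV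
    set S := (Sini n i).image ⇑(l.map (sT n)).prod with hS
    have h2 := wtS_sT hk S
    rw [List.length_cons] at hw
    have hk1 : (⟨k - 1, by omega⟩ : Fin n) ∈ S := by
      by_contra hc
      rw [if_neg hc] at h2
      omega
    have hk2 : (⟨k, hk.2⟩ : Fin n) ∉ S := by
      intro hc
      rw [if_pos hc, if_pos hk1] at h2
      omega
    rw [if_pos hk1, if_neg hk2] at h2
    have hkj : k ≠ j := by
      rintro rfl
      rcases hV with hV | hV
      · have := mem_Sini.1 (hV ((mem_image_sT S ⟨k, hk.2⟩).2 (by rw [sT_right hk]; exact hk1)))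
        simp at this
      · have := hV (mem_Sini.2 (show ((⟨k - 1, by omega⟩ : Fin n) : ℕ) < k by simp; omega))
        rw [mem_image_sT, sT_left hk] at this
        exact hk2 this
    rw [prodWord_cons, actS_mul, ih hl' (by omega), Qk_Est hk hkj]
    rw [← image_sT_sT (k := k) S, ← mem_Wfix.1 (sT_Wfix hk hkj)]
    exact hV.imp (fun h => Finset.image_subset_image h) (fun h => Finset.image_subset_image h)

end PP

/-- **Proposition 4.3 (pullpushdecomp) for `GL_n`:** fix `i ≠ j`, `g ∈ GL_n(F)`, and for each
`z ∈ (W_j)^{i,j}` a reduced word `red z`.  The map `⊔_{z} F^{ℓ(z)} → G/P_i`,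
`(z; d₁, …, d_r) ↦ g x_{k₁}(d₁) n_{k₁}⁻¹ ⋯ x_{k_r}(d_r) n_{k_r}⁻¹ P_i`, is a bijection onto
`{hP_i : hP_j = gP_j}`. -/
theorem pull_push_decomposition (F : Type*) [Field F] (n : ℕ) (hn : 2 ≤ n)
    (i j : ℕ) (hi1 : 1 ≤ i) (hi2 : i ≤ n - 1) (hj1 : 1 ≤ j) (hj2 : j ≤ n - 1) (hij : i ≠ j)
    (g : GL (Fin n) F)
    (red : Equiv.Perm (Fin n) → List ℕ)
    (hred : ∀ z ∈ minRepsIn n i j, IsReducedWord n (red z) z) :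
    Function.Injective
      (fun p : Σ z : {z : Equiv.Perm (Fin n) // z ∈ minRepsIn n i j}, Fin (red z.1).length → F =>
        (QuotientGroup.mk (g * prodWord F n (red p.1.1) p.2) : GL (Fin n) F ⧸ Pmax F n i)) ∧
    Set.range
        (fun p : Σ z : {z : Equiv.Perm (Fin n) // z ∈ minRepsIn n i j},
            Fin (red z.1).length → F =>
          (QuotientGroup.mk (g * prodWord F n (red p.1.1) p.2) : GL (Fin n) F ⧸ Pmax F n i)) =
      {x : GL (Fin n) F ⧸ Pmax F n i | ∃ h : GL (Fin n) F, QuotientGroup.mk h = x ∧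
        (QuotientGroup.mk h : GL (Fin n) F ⧸ Pmax F n j) = QuotientGroup.mk g} := by
  have hin : i ≤ n := by omega
  have hcell := fun (z : Equiv.Perm (Fin n)) (hz : z ∈ minRepsIn n i j) =>
    cell (F := F) i (red z) (hred z hz).1 (reduced_wt hin (minRepsIn_grass hz) (hred z hz))
  have hprod := fun (z : Equiv.Perm (Fin n)) (hz : z ∈ minRepsIn n i j) => (hred z hz).2.1
  refine ⟨?_, ?_⟩
  · rintro ⟨⟨z, hz⟩, c⟩ ⟨⟨z', hz'⟩, c'⟩ h
    have h1 := (mk_eq_iff i _ _).1 h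
    rw [actS_mul, actS_mul] at h1
    have h2 := congrArg (actS g⁻¹) h1
    rw [actS_inv_actS, actS_inv_actS] at h2
    have h3 := congrArg Piv h2
    rw [(hcell z hz).1, (hcell z' hz').1, hprod z hz, hprod z' hz'] at h3
    have h4 := grass_unique (minRepsIn_grass hz) (minRepsIn_grass hz') h3
    subst h4
    have h5 := (hcell z hz).2.2 c c' h2
    rw [h5]
  · ext x
    constructor
    · rintro ⟨⟨⟨z, hz⟩, c⟩, rfl⟩
      refine ⟨g * prodWord F n (red z) c, rfl, ?_⟩
      rw [mk_eq_iff, actS_mul, word_Est i j (red z) (hred z hz).1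
        (reduced_wt hin (minRepsIn_grass hz) (hred z hz))]
      rw [hprod z hz, ← mem_Wfix.1 hz.1]
      rcases le_total i j with hle | hle
      · left
        apply Finset.image_subset_image
        intro a ha
        rw [mem_Sini] at *
        omega
      · right
        apply Finset.image_subset_image
        intro a ha
        rw [mem_Sini] at *
        omega
    · rintro ⟨h, rfl, hh⟩
      rw [mk_eq_iff] at hh
      have hh' : actS (g⁻¹ * h) (Est F n j) = Est F n j := by
        rw [actS_mul, hh, actS_inv_actS]
      set V := actS (g⁻¹ * h) (Est F n i) with hV
      have hsub : Piv V ⊆ Sini n j ∨ Sini n j ⊆ Piv V := by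
        rw [← Piv_Est (F := F) j]
        rcases le_total i j with hle | hle
        · left
          apply Piv_mono
          rw [← hh']
          exact actS_mono _ (Est_mono hle)
        · right
          apply Piv_mono
          conv_lhs => rw [← hh']
          exact actS_mono _ (Est_mono hle)
      obtain ⟨p, w, hw, e1, e2⟩ := exists_perm j _ V rfl hsub
      rw [hV, finrank_actS] at e2
      rw [← Est_finrank_inj e2] at e1
      obtain ⟨z, hz, hzw⟩ := exists_min i j w hw
      rw [← hzw] at e1
      obtain ⟨c, hc⟩ := (hcell z hz).2.1 V (by rw [hprod z hz, e1])
      refine ⟨⟨⟨z, hz⟩, c⟩, ?_⟩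
      show (QuotientGroup.mk (g * prodWord F n (red z) c) : GL (Fin n) F ⧸ Pmax F n i) = _
      rw [mk_eq_iff, actS_mul, ← hc, hV, ← actS_mul, mul_inv_cancel_left]
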